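/- Let a<b and λ>0, let g : [a,b] → [0,1] be a nondecreasing function with g₊(a)=0 and g₋(b)=1, and let g^{-1}(c) := inf{x ∈ [a,b] : g(x) ≥ c} denote its left-continuous generalized inverse. Assume there exist 0 < c₁ < c₂ < 1 with 2λ∫_a^{g^{-1}(c₁)} (c₁ − g(x)) dx = 1 and 2λ∫_{g^{-1}(c₂)}^{b} (g(x) − c₂) dx = 1. Then the function u defined by u(x) := c₁ for a ≤ x ≤ g^{-1}(c₁), u(x) := g(x) for g^{-1}(c₁) < x ≤ g^{-1}(c₂), and u(x) := c₂ for g^{-1}(c₂) < x ≤ b, is the unique minimizer of ROF_{λ,g} over BV(]a,b[). -/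

import Mathlib

open MeasureTheory Filter Set Topology
open scoped ENNReal NNReal

noncomputable section

/-- `Ψ₁(t) = ∫_{-∞}^t ψ(s) ds`. -/
def Psi1 (ψ : ℝ → ℝ) (t : ℝ) : ℝ := ∫ s in Set.Iic t, ψ s

/-- `Ψ_p(t) = ∫_{-∞}^t ψ(s)^{1/p} ds`. -/
def Psip (ψ : ℝ → ℝ) (p t : ℝ) : ℝ := ∫ s in Set.Iic t, ψ s ^ (1 / p)

/-- The natural extension of `Ψ₁` to the extended reals:
`Ψ₁(-∞) = 0`, `Ψ₁(+∞) = ∫_ℝ ψ`. -/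
def Psi1E (ψ : ℝ → ℝ) (t : EReal) : ℝ :=
  if t = ⊤ then ∫ s, ψ s else if t = ⊥ then 0 else Psi1 ψ t.toReal

/-- Standing assumptions on `ψ` in the case `p = 1`: a bounded, everywhere positive
Borel function, integrable on `ℝ`, whose infimum on every compact set is positive. -/
structure PsiHyp (ψ : ℝ → ℝ) : Prop where
  measurable : Measurable ψ
  pos : ∀ t, 0 < ψ t
  bounded : ∃ C, ∀ t, ψ t ≤ C
  integrable : MeasureTheory.Integrable ψ
  inf_pos : ∀ K : Set ℝ, IsCompact K → ∃ δ > 0, ∀ t ∈ K, δ ≤ ψ t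

/-- Standing assumptions on `ψ` in the case `p > 1`: as in `PsiHyp` but with
`ψ^{1/p}` integrable on `ℝ`. -/
structure PsiHypP (ψ : ℝ → ℝ) (p : ℝ) : Prop where
  measurable : Measurable ψ
  pos : ∀ t, 0 < ψ t
  bounded : ∃ C, ∀ t, ψ t ≤ C
  integrable : MeasureTheory.Integrable fun t => ψ t ^ (1 / p)
  inf_pos : ∀ K : Set ℝ, IsCompact K → ∃ δ > 0, ∀ t ∈ K, δ ≤ ψ t

/-- `(μp, μn)` is the Jordan decomposition of the distributional derivative of
`u ∈ L¹(]a,b[)`; the existence of such a pair encodes `u ∈ BV(]a,b[)`,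
and `μp + μn` is the total variation measure `|u'|`. -/
def IsDerivMeasures (a b : ℝ) (u : ℝ → ℝ) (μp μn : Measure ℝ) : Prop :=
  MeasureTheory.IntegrableOn u (Set.Ioo a b) ∧
  IsFiniteMeasure μp ∧ IsFiniteMeasure μn ∧ μp ⟂ₘ μn ∧
  μp (Set.Ioo a b)ᶜ = 0 ∧ μn (Set.Ioo a b)ᶜ = 0 ∧
  ∀ φ : ℝ → ℝ, ContDiff ℝ 1 φ → tsupport φ ⊆ Set.Ioo a b →
    ∫ x in Set.Ioo a b, u x * deriv φ x = (∫ x, φ x ∂μn) - ∫ x, φ x ∂μp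

/-- The density `(u')^a` of the absolutely continuous part of the derivative whose
Jordan decomposition is `(μp, μn)`. -/
def uaD (μp μn : Measure ℝ) (x : ℝ) : ℝ :=
  (μp.rnDeriv MeasureTheory.volume x).toReal - (μn.rnDeriv MeasureTheory.volume x).toReal

/-- Left approximate limit `u₋(y) = lim_{ε→0⁺} ε⁻¹ ∫_{y-ε}^y u`. -/
def leftApproxLim (u : ℝ → ℝ) (y : ℝ) : ℝ :=
  limUnder (𝓝[>] (0 : ℝ)) fun ε => (∫ x in Set.Ioo (y - ε) y, u x) / ε

/-- Right approximate limit `u₊(y) = lim_{ε→0⁺} ε⁻¹ ∫_y^{y+ε} u`. -/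
def rightApproxLim (u : ℝ → ℝ) (y : ℝ) : ℝ :=
  limUnder (𝓝[>] (0 : ℝ)) fun ε => (∫ x in Set.Ioo y (y + ε), u x) / ε

/-- Left approximate limit computed in the extended reals (may be `±∞`). -/
def leftApproxLimE (u : ℝ → ℝ) (y : ℝ) : EReal :=
  limUnder (𝓝[>] (0 : ℝ)) fun ε => (((∫ x in Set.Ioo (y - ε) y, u x) / ε : ℝ) : EReal)

/-- Right approximate limit computed in the extended reals (may be `±∞`). -/
def rightApproxLimE (u : ℝ → ℝ) (y : ℝ) : EReal :=
  limUnder (𝓝[>] (0 : ℝ)) fun ε => (((∫ x in Set.Ioo y (y + ε), u x) / ε : ℝ) : EReal)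

/-- The jump set `S_u` of `u` in `]a,b[`. -/
def jumpSet (a b : ℝ) (u : ℝ → ℝ) : Set ℝ :=
  {y | y ∈ Set.Ioo a b ∧ leftApproxLim u y ≠ rightApproxLim u y}

/-- `ν_u = sign(u₊ - u₋)`. -/
def jumpSign (u : ℝ → ℝ) (y : ℝ) : ℝ :=
  Real.sign (rightApproxLim u y - leftApproxLim u y)

/-- `Z⁺[w] = {x ∈ ]a,b[ : lim_{ε→0⁺} (2ε)⁻¹∫_{x-ε}^{x+ε} w = +∞}`. -/
def ZPlus (a b : ℝ) (w : ℝ → ℝ) : Set ℝ :=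
  {x | x ∈ Set.Ioo a b ∧
    Tendsto (fun ε => (∫ t in Set.Ioo (x - ε) (x + ε), w t) / (2 * ε)) (𝓝[>] (0 : ℝ)) atTop}

/-- `Z⁻[w] = {x ∈ ]a,b[ : lim_{ε→0⁺} (2ε)⁻¹∫_{x-ε}^{x+ε} w = -∞}`. -/
def ZMinus (a b : ℝ) (w : ℝ → ℝ) : Set ℝ :=
  {x | x ∈ Set.Ioo a b ∧
    Tendsto (fun ε => (∫ t in Set.Ioo (x - ε) (x + ε), w t) / (2 * ε)) (𝓝[>] (0 : ℝ)) atBot}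

/-- The positive part `((u')^c)⁺` of the Cantor part of the derivative of `u`:
the singular part of `μp` with the atoms on the jump set removed. -/
def cantorPos (a b : ℝ) (u : ℝ → ℝ) (μp : Measure ℝ) : Measure ℝ :=
  (μp.singularPart MeasureTheory.volume).restrict (jumpSet a b u)ᶜ

/-- The negative part `((u')^c)⁻` of the Cantor part of the derivative of `u`. -/
def cantorNeg (a b : ℝ) (u : ℝ → ℝ) (μn : Measure ℝ) : Measure ℝ :=
  (μn.singularPart MeasureTheory.volume).restrict (jumpSet a b u)ᶜ

/-- `u ∈ X¹_ψ(]a,b[)`, with derivative data `(μp, μn)`:  `u ∈ BV(]a,b[)`,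
`Ψ₁∘(u')^a ∈ BV(]a,b[)`, and `((u')^c)^±` is concentrated on `Z^±[(u')^a]`. -/
def MemX1 (ψ : ℝ → ℝ) (a b : ℝ) (u : ℝ → ℝ) (μp μn : Measure ℝ) : Prop :=
  IsDerivMeasures a b u μp μn ∧
  (∃ νp νn : Measure ℝ, IsDerivMeasures a b (fun x => Psi1 ψ (uaD μp μn x)) νp νn) ∧
  cantorPos a b u μp (ZPlus a b (uaD μp μn))ᶜ = 0 ∧
  cantorNeg a b u μn (ZMinus a b (uaD μp μn))ᶜ = 0

/-- `f ∈ W^{1,p}(]a,b[)`: `f` has an absolutely continuous representative whose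
pointwise a.e. derivative lies in `L^p(]a,b[)`. -/
def MemW1pOn (p a b : ℝ) (f : ℝ → ℝ) : Prop :=
  ∃ g w : ℝ → ℝ,
    (∀ᵐ x ∂(MeasureTheory.volume.restrict (Set.Ioo a b)), g x = f x) ∧
    MeasureTheory.IntegrableOn w (Set.Ioo a b) ∧
    MeasureTheory.IntegrableOn (fun x => |w x| ^ p) (Set.Ioo a b) ∧
    ∀ x ∈ Set.Ioo a b, ∀ y ∈ Set.Ioo a b, g y - g x = ∫ t in x..y, w t

/-- `u ∈ X^p_ψ(]a,b[)`, with derivative data `(μp, μn)`:  `u ∈ BV(]a,b[)`,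
`Ψ_p∘(u')^a ∈ W^{1,p}(]a,b[)`, and `((u')^s)^±` is concentrated on `Z^±[(u')^a]`. -/
def MemXp (ψ : ℝ → ℝ) (p a b : ℝ) (u : ℝ → ℝ) (μp μn : Measure ℝ) : Prop :=
  IsDerivMeasures a b u μp μn ∧
  MemW1pOn p a b (fun x => Psip ψ p (uaD μp μn x)) ∧
  (μp.singularPart MeasureTheory.volume) (ZPlus a b (uaD μp μn))ᶜ = 0 ∧
  (μn.singularPart MeasureTheory.volume) (ZMinus a b (uaD μp μn))ᶜ = 0

/-- `u ∈ W^{2,p}(]a,b[)` with first derivative `v` and second derivative `w`. -/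
def W2pRep (p a b : ℝ) (u v w : ℝ → ℝ) : Prop :=
  (∀ x ∈ Set.Ioo a b, HasDerivAt u (v x) x) ∧
  (∀ x ∈ Set.Ioo a b, ∀ y ∈ Set.Ioo a b, v y - v x = ∫ t in x..y, w t) ∧
  MeasureTheory.IntegrableOn u (Set.Ioo a b) ∧
  MeasureTheory.IntegrableOn v (Set.Ioo a b) ∧
  MeasureTheory.IntegrableOn w (Set.Ioo a b) ∧
  MeasureTheory.IntegrableOn (fun x => |w x| ^ p) (Set.Ioo a b)

/-- The functional `F_p(u) = ∫_a^b |u'| + ∫_a^b ψ(u')|u''|^p` if `u ∈ W^{2,p}(]a,b[)`,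
`+∞` otherwise (as an infimum over Sobolev representations). -/
def Fp (ψ : ℝ → ℝ) (p a b : ℝ) (u : ℝ → ℝ) : ℝ≥0∞ :=
  ⨅ (v : ℝ → ℝ) (w : ℝ → ℝ) (_ : W2pRep p a b u v w),
    ENNReal.ofReal ((∫ x in Set.Ioo a b, |v x|) + ∫ x in Set.Ioo a b, ψ (v x) * |w x| ^ p)

/-- Strong `L¹(]a,b[)` convergence of a sequence. -/
def TendstoL1 (a b : ℝ) (U : ℕ → ℝ → ℝ) (u : ℝ → ℝ) : Prop :=
  (∀ k, MeasureTheory.IntegrableOn (U k) (Set.Ioo a b)) ∧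
  MeasureTheory.IntegrableOn u (Set.Ioo a b) ∧
  Tendsto (fun k => ∫ x in Set.Ioo a b, |U k x - u x|) atTop (𝓝 0)

/-- The relaxed functional
`F̄_p(u) = inf { liminf_k F_p(u_k) : u_k → u in L¹(]a,b[) }`. -/
def FpRel (ψ : ℝ → ℝ) (p a b : ℝ) (u : ℝ → ℝ) : ℝ≥0∞ :=
  ⨅ (U : ℕ → ℝ → ℝ) (_ : TendstoL1 a b U u),
    liminf (fun k => Fp ψ p a b (U k)) atTop

/-- `Φ(s, t₁, t₂)` of the relaxation formula (`s` being the sign of the jump). -/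
def Phi (ψ : ℝ → ℝ) (s : ℝ) (t₁ t₂ : EReal) : ℝ :=
  if 0 < s then ((∫ t, ψ t) - Psi1E ψ t₁) + ((∫ t, ψ t) - Psi1E ψ t₂)
  else Psi1E ψ t₁ + Psi1E ψ t₂

/-- `Φ̂(s, t₁, t₂)` of Remark 2.5. -/
def PhiHat (ψ : ℝ → ℝ) (s : ℝ) (t₁ t₂ : EReal) : ℝ :=
  if 0 < s then (∫ t, ψ t) - Psi1E ψ (max t₁ t₂)
  else Psi1E ψ (min t₁ t₂)

/-- `ubar` is a `C¹([a,b])` representative of `u`. -/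
def C1Rep (a b : ℝ) (u ubar : ℝ → ℝ) : Prop :=
  (∀ᵐ x ∂(MeasureTheory.volume.restrict (Set.Ioo a b)), ubar x = u x) ∧
  ContDiffOn ℝ 1 ubar (Set.Icc a b)

/-- `u` solves `min { F̄₁(w) + λ ∫_a^b (w - G)² : w ∈ X¹_ψ(]a,b[) }`. -/
def IsSolution1 (ψ : ℝ → ℝ) (a b lam : ℝ) (G u : ℝ → ℝ) : Prop :=
  (∃ μp μn : Measure ℝ, MemX1 ψ a b u μp μn) ∧
  ∀ w : ℝ → ℝ, (∃ ηp ηn : Measure ℝ, MemX1 ψ a b w ηp ηn) →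
    FpRel ψ 1 a b u + ENNReal.ofReal (lam * ∫ x in Set.Ioo a b, (u x - G x) ^ 2) ≤
    FpRel ψ 1 a b w + ENNReal.ofReal (lam * ∫ x in Set.Ioo a b, (w x - G x) ^ 2)

/-- `u` solves `min { F̄_p(w) + λ ∫_a^b |w - G|² : w ∈ X^p_ψ(]a,b[) }`. -/
def IsSolutionP (ψ : ℝ → ℝ) (p a b lam : ℝ) (G u : ℝ → ℝ) : Prop :=
  (∃ μp μn : Measure ℝ, MemXp ψ p a b u μp μn) ∧
  ∀ w : ℝ → ℝ, (∃ ηp ηn : Measure ℝ, MemXp ψ p a b w ηp ηn) →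
    FpRel ψ p a b u + ENNReal.ofReal (lam * ∫ x in Set.Ioo a b, (u x - G x) ^ 2) ≤
    FpRel ψ p a b w + ENNReal.ofReal (lam * ∫ x in Set.Ioo a b, (w x - G x) ^ 2)

/-- The Rudin–Osher–Fatemi energy `|w'|(]a,b[) + λ∫_a^b (w-g)²`, where `(ηp, ηn)`
is the Jordan decomposition of the derivative of `w`. -/
def ROFenergy (a b lam : ℝ) (g w : ℝ → ℝ) (ηp ηn : Measure ℝ) : ℝ≥0∞ :=
  (ηp + ηn) (Set.Ioo a b) + ENNReal.ofReal (lam * ∫ x in Set.Ioo a b, (w x - g x) ^ 2)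

/-- The left-continuous generalized inverse `g^{-1}(c) = inf {x ∈ [a,b] : g(x) ≥ c}`. -/
def gInv (a b : ℝ) (g : ℝ → ℝ) (c : ℝ) : ℝ :=
  sInf {x | x ∈ Set.Icc a b ∧ c ≤ g x}

end

noncomputable section
open MeasureTheory Filter Set Topology
open scoped ENNReal NNReal

/-- The candidate minimizer of Proposition `rof`:
`u = c₁` on `[a, g⁻¹(c₁)]`, `u = g` on `]g⁻¹(c₁), g⁻¹(c₂)]`, `u = c₂` afterwards. -/
noncomputable def rofU (a b : ℝ) (g : ℝ → ℝ) (c₁ c₂ : ℝ) (x : ℝ) : ℝ :=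
  if x ≤ gInv a b g c₁ then c₁ else if x ≤ gInv a b g c₂ then g x else c₂

/-- Fubini for a distribution function: `∫ η(]-∞, x]) ζ(x) dm(x) = ∫ (∫_{[t, ∞[} ζ dm) dη(t)`. -/
lemma integral_measureReal_Iic_mul {m η : Measure ℝ} [SFinite m] [IsFiniteMeasure η]
    {ζ : ℝ → ℝ} (hζ : Integrable ζ m) :
    Integrable (fun x => η.real (Iic x) * ζ x) m ∧
      Integrable (fun t => ∫ x in Ici t, ζ x ∂m) η ∧
      ∫ x, η.real (Iic x) * ζ x ∂m = ∫ t, (∫ x in Ici t, ζ x ∂m) ∂η := by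
  have hmeas : MeasurableSet {p : ℝ × ℝ | p.2 ≤ p.1} :=
    measurableSet_le measurable_snd measurable_fst
  have hInt : Integrable ({p : ℝ × ℝ | p.2 ≤ p.1}.indicator fun p => ζ p.1) (m.prod η) :=
    (hζ.comp_fst η).indicator hmeas
  have hinner : ∀ x, ∫ t, ({p : ℝ × ℝ | p.2 ≤ p.1}.indicator fun p => ζ p.1) (x, t) ∂η
      = η.real (Iic x) * ζ x := by
    intro x
    have : (fun t => ({p : ℝ × ℝ | p.2 ≤ p.1}.indicator fun p => ζ p.1) (x, t))
        = (Iic x).indicator fun _ => ζ x := by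
      ext t; simp [indicator]
    rw [this, integral_indicator_const _ measurableSet_Iic, smul_eq_mul]
  have houter : ∀ t, ∫ x, ({p : ℝ × ℝ | p.2 ≤ p.1}.indicator fun p => ζ p.1) (x, t) ∂m
      = ∫ x in Ici t, ζ x ∂m := by
    intro t
    rw [← integral_indicator measurableSet_Ici]
    congr 1
  refine ⟨?_, ?_, ?_⟩
  · simpa only [hinner] using hInt.integral_prod_left
  · simpa only [houter] using hInt.integral_prod_right
  · have := integral_integral_swap
      (f := fun x t => ({p : ℝ × ℝ | p.2 ≤ p.1}.indicator fun p => ζ p.1) (x, t)) hInt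
    simpa only [hinner, houter] using this

lemma measurable_measureReal_Iic (η : Measure ℝ) [IsFiniteMeasure η] :
    Measurable fun x => η.real (Iic x) :=
  Monotone.measurable fun _ _ h => measureReal_mono (Iic_subset_Iic.2 h)

lemma integrableOn_measureReal_Iic (η : Measure ℝ) [IsFiniteMeasure η] (a b : ℝ) :
    IntegrableOn (fun x => η.real (Iic x)) (Ioo a b) := by
  refine Integrable.of_bound (measurable_measureReal_Iic η).aestronglyMeasurable (η.real univ)
    (ae_of_all _ fun x => ?_)
  rw [Real.norm_of_nonneg measureReal_nonneg]
  exact measureReal_mono (subset_univ _)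

lemma exists_tsupport_subset_Icc {a b : ℝ} (hab : a < b) {φ : ℝ → ℝ}
    (hφ : tsupport φ ⊆ Ioo a b) : ∃ α β, a < α ∧ β < b ∧ α < β ∧ tsupport φ ⊆ Icc α β := by
  have hc : IsCompact (tsupport φ) :=
    isCompact_Icc.of_isClosed_subset (isClosed_tsupport φ) (hφ.trans Ioo_subset_Icc_self)
  rcases (tsupport φ).eq_empty_or_nonempty with h | h
  · exact ⟨(2 * a + b) / 3, (a + 2 * b) / 3, by linarith, by linarith, by linarith, by simp [h]⟩
  · obtain ⟨α, hα, hα'⟩ := hc.exists_isLeast h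
    obtain ⟨β, hβ, hβ'⟩ := hc.exists_isGreatest h
    have h1 := hφ hα
    have h2 := hφ hβ
    have h3 := hα' hβ
    exact ⟨(a + α) / 2, β, by linarith [h1.1], h2.2, by linarith [h1.1],
      fun x hx => ⟨by linarith [hα' hx, h1.1], hβ' hx⟩⟩

lemma integrableOn_deriv_Ioo {a b : ℝ} {φ : ℝ → ℝ} (hφ : ContDiff ℝ 1 φ) :
    IntegrableOn (deriv φ) (Ioo a b) :=
  ((hφ.continuous_deriv le_rfl).integrableOn_Icc (a := a) (b := b)).mono_set Ioo_subset_Icc_self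

lemma setIntegral_Ici_deriv {a b : ℝ} {φ : ℝ → ℝ} (hφ : ContDiff ℝ 1 φ)
    (hs : tsupport φ ⊆ Ioo a b) {t : ℝ} (ht : t ∈ Ioo a b) :
    ∫ x in Ici t, deriv φ x ∂(volume.restrict (Ioo a b)) = -φ t := by
  have hset : Ici t ∩ Ioo a b = Ico t b := by
    ext x; simp only [mem_inter_iff, mem_Ici, mem_Ioo, mem_Ico]
    exact ⟨fun h => ⟨h.1, h.2.2⟩, fun h => ⟨h.1, ht.1.trans_le h.1, h.2⟩⟩
  have hb : φ b = 0 := image_eq_zero_of_notMem_tsupport fun h => (hs h).2.false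
  rw [Measure.restrict_restrict measurableSet_Ici, hset, integral_Ico_eq_integral_Ioo,
    ← integral_Ioc_eq_integral_Ioo, ← intervalIntegral.integral_of_le ht.2.le,
    intervalIntegral.integral_deriv_eq_sub
      (fun x _ => (hφ.differentiable one_ne_zero).differentiableAt)
      ((hφ.continuous_deriv le_rfl).intervalIntegrable _ _), hb, zero_sub]

lemma setIntegral_Ioo_deriv {a b : ℝ} (hab : a < b) {φ : ℝ → ℝ} (hφ : ContDiff ℝ 1 φ)
    (hs : tsupport φ ⊆ Ioo a b) : ∫ x in Ioo a b, deriv φ x = 0 := by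
  have hb : φ b = 0 := image_eq_zero_of_notMem_tsupport fun h => (hs h).2.false
  have ha : φ a = 0 := image_eq_zero_of_notMem_tsupport fun h => (hs h).1.false
  rw [← integral_Ioc_eq_integral_Ioo, ← intervalIntegral.integral_of_le hab.le,
    intervalIntegral.integral_deriv_eq_sub
      (fun x _ => (hφ.differentiable one_ne_zero).differentiableAt)
      ((hφ.continuous_deriv le_rfl).intervalIntegrable _ _), hb, ha, sub_zero]

/-- The distribution function of a finite measure on `]a,b[` has that measure as its
distributional derivative. -/
lemma setIntegral_measureReal_Iic_mul_deriv {a b : ℝ} {η : Measure ℝ} [IsFiniteMeasure η]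
    (hη : η (Ioo a b)ᶜ = 0) {φ : ℝ → ℝ} (hφ : ContDiff ℝ 1 φ) (hs : tsupport φ ⊆ Ioo a b) :
    ∫ x in Ioo a b, η.real (Iic x) * deriv φ x = -∫ x, φ x ∂η := by
  rw [(integral_measureReal_Iic_mul (η := η) (integrableOn_deriv_Ioo hφ)).2.2, ← integral_neg]
  refine integral_congr_ae ?_
  filter_upwards [mem_ae_iff.2 hη] with t ht
  exact setIntegral_Ici_deriv hφ hs ht

/-- A continuous function of zero mean supported in `]a,b[` is the derivative of a `C¹` function
supported in `]a,b[`. -/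
lemma exists_contDiff_deriv_eq {a b : ℝ} (hab : a < b) {ρ : ℝ → ℝ} (hρ : Continuous ρ)
    (hs : tsupport ρ ⊆ Ioo a b) (h0 : ∫ x in Ioo a b, ρ x = 0) :
    ∃ φ : ℝ → ℝ, ContDiff ℝ 1 φ ∧ tsupport φ ⊆ Ioo a b ∧ deriv φ = ρ := by
  obtain ⟨α, β, haα, hβb, hαβ, hsupp⟩ := exists_tsupport_subset_Icc hab hs
  have hzero : ∀ x, x ∉ Icc α β → ρ x = 0 := fun x hx =>
    image_eq_zero_of_notMem_tsupport fun h => hx (hsupp h)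
  have hder : ∀ x, HasDerivAt (fun y => ∫ t in a..y, ρ t) (ρ x) x := fun x =>
    intervalIntegral.integral_hasDerivAt_right (hρ.intervalIntegrable _ _)
      hρ.aestronglyMeasurable.stronglyMeasurableAtFilter hρ.continuousAt
  have hderiv : deriv (fun y => ∫ t in a..y, ρ t) = ρ := funext fun x => (hder x).deriv
  have htotal : ∫ t in a..b, ρ t = 0 := by
    rw [intervalIntegral.integral_of_le hab.le, integral_Ioc_eq_integral_Ioo, h0]
  refine ⟨fun y => ∫ t in a..y, ρ t, ?_, ?_, hderiv⟩
  · rw [contDiff_one_iff_deriv, hderiv]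
    exact ⟨fun x => (hder x).differentiableAt, hρ⟩
  · refine (closure_minimal ?_ isClosed_Icc).trans (Icc_subset_Ioo haα hβb)
    intro x hx
    by_contra hx'
    refine hx ?_
    rcases lt_or_ge x α with h | h
    · refine (intervalIntegral.integral_congr (g := fun _ => 0)
        fun t ht => hzero t fun h' => ?_).trans (by simp)
      rcases mem_uIcc.1 ht with h2 | h2 <;> linarith [h'.1, h2.1, h2.2]
    · have hβ : β < x := by
        by_contra hcon
        exact hx' ⟨h, not_lt.1 hcon⟩
      have hrest : ∫ t in b..x, ρ t = 0 := by
        refine (intervalIntegral.integral_congr (g := fun _ => 0)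
          fun t ht => hzero t fun h' => ?_).trans (by simp)
        rcases mem_uIcc.1 ht with h2 | h2 <;> linarith [h'.2, h2.1, h2.2]
      have := intervalIntegral.integral_add_adjacent_intervals
        (hρ.intervalIntegrable (μ := volume) a b) (hρ.intervalIntegrable b x)
      change ∫ t in a..x, ρ t = 0
      rw [← this, htotal, hrest, add_zero]

/-- The du Bois-Reymond lemma: a function on `]a,b[` with vanishing distributional derivative is
almost everywhere constant. -/
lemma ae_eq_const_of_forall_setIntegral_mul_deriv_eq_zero {a b : ℝ} (hab : a < b) {h : ℝ → ℝ}
    (hh : IntegrableOn h (Ioo a b))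
    (h0 : ∀ φ : ℝ → ℝ, ContDiff ℝ 1 φ → tsupport φ ⊆ Ioo a b →
      ∫ x in Ioo a b, h x * deriv φ x = 0) :
    ∃ C : ℝ, ∀ᵐ x ∂(volume.restrict (Ioo a b)), h x = C := by
  let κ : ContDiffBump ((a + b) / 2) := ⟨(b - a) / 8, (b - a) / 4, by linarith, by linarith⟩
  let κ₀ : ℝ → ℝ := κ.normed volume
  have hκc : Continuous κ₀ := κ.continuous_normed
  have hκs : tsupport κ₀ ⊆ Ioo a b := by
    rw [show tsupport κ₀ = Metric.closedBall ((a + b) / 2) ((b - a) / 4) from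
      κ.tsupport_normed_eq, Real.closedBall_eq_Icc]
    exact Icc_subset_Ioo (by linarith) (by linarith)
  have hκ1 : ∫ x in Ioo a b, κ₀ x = 1 := by
    rw [setIntegral_eq_integral_of_forall_compl_eq_zero fun x hx =>
      image_eq_zero_of_notMem_tsupport fun h' => hx (hκs h')]
    exact κ.integral_normed
  have hmul : ∀ ρ : ℝ → ℝ, Continuous ρ → IntegrableOn (fun x => h x * ρ x) (Ioo a b) := by
    intro ρ hρ
    obtain ⟨K, hK⟩ := isCompact_Icc.exists_bound_of_continuousOn (hρ.continuousOn (s := Icc a b))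
    exact hh.mul_bdd hρ.aestronglyMeasurable ((ae_restrict_iff' measurableSet_Ioo).2
      (ae_of_all _ fun x hx => hK x (Ioo_subset_Icc_self hx)))
  have hInt : ∀ ρ : ℝ → ℝ, Continuous ρ → IntegrableOn ρ (Ioo a b) := fun ρ hρ =>
    (hρ.integrableOn_Icc (a := a) (b := b)).mono_set Ioo_subset_Icc_self
  set C := ∫ x in Ioo a b, h x * κ₀ x with hC
  refine ⟨C, ?_⟩
  have key := isOpen_Ioo.ae_eq_zero_of_integral_contDiff_smul_eq_zero (U := Ioo a b)
    (μ := (volume : Measure ℝ)) (f := fun x => h x - C)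
    ((hh.sub (integrableOn_const (by simp))).locallyIntegrableOn) ?_
  · rw [ae_restrict_iff' measurableSet_Ioo]
    filter_upwards [key] with x hx hx'
    linarith [hx hx']
  intro ψ hψ _ hψs
  have hψc := hψ.continuous
  set I := ∫ x in Ioo a b, ψ x with hI
  obtain ⟨φ, hφ, hφs, hφd⟩ := exists_contDiff_deriv_eq hab (ρ := fun x => ψ x - I * κ₀ x)
    (by fun_prop)
    ((tsupport_sub ψ fun x => I * κ₀ x).trans (union_subset hψs
      ((closure_mono fun x hx => right_ne_zero_of_mul hx).trans hκs)))
    (by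
      rw [integral_sub (hInt _ hψc) ((hInt _ hκc).const_mul I), integral_const_mul, hκ1]
      simp [hI])
  have := h0 φ hφ hφs
  rw [hφd] at this
  have hsplit : ∫ x in Ioo a b, h x * (ψ x - I * κ₀ x)
      = (∫ x in Ioo a b, h x * ψ x) - I * C := by
    rw [hC, ← integral_const_mul, ← integral_sub (hmul _ hψc) ((hmul _ hκc).const_mul I)]
    congr 1; ext x; ring
  rw [← setIntegral_eq_integral_of_forall_compl_eq_zero (s := Ioo a b) fun x hx => by
    rw [image_eq_zero_of_notMem_tsupport fun h' => hx (hψs h'), zero_smul]]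
  have h2 : ∫ x in Ioo a b, ψ x • (h x - C) = (∫ x in Ioo a b, h x * ψ x) - C * I := by
    rw [hI, ← integral_const_mul, ← integral_sub (hmul _ hψc) ((hInt _ hψc).const_mul C)]
    congr 1; ext x; simp only [smul_eq_mul]; ring
  rw [h2]
  linarith

/-- A `BV` function of one variable is almost everywhere a constant plus the distribution function
of its derivative. -/
lemma IsDerivMeasures.exists_ae_eq {a b : ℝ} (hab : a < b) {w : ℝ → ℝ} {ηp ηn : Measure ℝ}
    (hw : IsDerivMeasures a b w ηp ηn) :
    ∃ C : ℝ, ∀ᵐ x ∂(volume.restrict (Ioo a b)),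
      w x = C + ηp.real (Iic x) - ηn.real (Iic x) := by
  obtain ⟨hwi, hp, hn, -, hp0, hn0, hder⟩ := hw
  have hzero : ∀ φ : ℝ → ℝ, ContDiff ℝ 1 φ → tsupport φ ⊆ Ioo a b →
      ∫ x in Ioo a b, (w x - ηp.real (Iic x) + ηn.real (Iic x)) * deriv φ x = 0 := by
    intro φ hφ hφs
    have hd := integrableOn_deriv_Ioo (a := a) (b := b) hφ
    have hP := (integral_measureReal_Iic_mul (η := ηp) hd).1
    have hN := (integral_measureReal_Iic_mul (η := ηn) hd).1
    have hW : IntegrableOn (fun x => w x * deriv φ x) (Ioo a b) := by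
      have hc := hφ.continuous_deriv le_rfl
      obtain ⟨K, hK⟩ := isCompact_Icc.exists_bound_of_continuousOn (hc.continuousOn (s := Icc a b))
      exact hwi.mul_bdd hc.aestronglyMeasurable ((ae_restrict_iff' measurableSet_Ioo).2
        (ae_of_all _ fun x hx => hK x (Ioo_subset_Icc_self hx)))
    have : ∀ x, (w x - ηp.real (Iic x) + ηn.real (Iic x)) * deriv φ x
        = w x * deriv φ x - ηp.real (Iic x) * deriv φ x + ηn.real (Iic x) * deriv φ x :=
      fun x => by ring
    simp only [this]
    have hWP : Integrable (fun x => w x * deriv φ x - ηp.real (Iic x) * deriv φ x)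
        (volume.restrict (Ioo a b)) := hW.sub hP
    rw [integral_add hWP hN, integral_sub hW hP, hder φ hφ hφs,
      setIntegral_measureReal_Iic_mul_deriv hp0 hφ hφs,
      setIntegral_measureReal_Iic_mul_deriv hn0 hφ hφs]
    ring
  obtain ⟨C, hC⟩ := ae_eq_const_of_forall_setIntegral_mul_deriv_eq_zero hab
    ((hwi.sub (integrableOn_measureReal_Iic ηp a b)).add (integrableOn_measureReal_Iic ηn a b))
    hzero
  refine ⟨C, ?_⟩
  filter_upwards [hC] with x hx
  simp only [Pi.add_apply, Pi.sub_apply] at hx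
  linarith

/-- A constant plus the distribution function of a finite measure on `]a,b[` is `BV`. -/
lemma isDerivMeasures_of_ae_eq {a b : ℝ} (hab : a < b) {u : ℝ → ℝ} {μ : Measure ℝ}
    [IsFiniteMeasure μ] (hμ : μ (Ioo a b)ᶜ = 0) {C : ℝ}
    (hu : ∀ᵐ x ∂(volume.restrict (Ioo a b)), u x = C + μ.real (Iic x)) :
    IsDerivMeasures a b u μ 0 := by
  refine ⟨?_, inferInstance, inferInstance, Measure.MutuallySingular.zero_right, hμ, by simp, ?_⟩
  · exact ((integrableOn_const (C := C) (by simp)).add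
      (integrableOn_measureReal_Iic μ a b)).congr (hu.mono fun x hx => hx.symm)
  intro φ hφ hφs
  have hd := integrableOn_deriv_Ioo (a := a) (b := b) hφ
  have hcongr : ∫ x in Ioo a b, u x * deriv φ x
      = ∫ x in Ioo a b, (C * deriv φ x + μ.real (Iic x) * deriv φ x) :=
    integral_congr_ae (hu.mono fun x hx => by simp only [hx]; ring)
  rw [hcongr, integral_add (hd.const_mul C) (integral_measureReal_Iic_mul hd).1,
    integral_const_mul, setIntegral_Ioo_deriv hab hφ hφs,
    setIntegral_measureReal_Iic_mul_deriv hμ hφ hφs]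
  simp

lemma memLp_two_of_ae_eq {a b : ℝ} {w : ℝ → ℝ} {ηp ηn : Measure ℝ} [IsFiniteMeasure ηp]
    [IsFiniteMeasure ηn] {C : ℝ}
    (hw : ∀ᵐ x ∂(volume.restrict (Ioo a b)), w x = C + ηp.real (Iic x) - ηn.real (Iic x)) :
    MemLp w 2 (volume.restrict (Ioo a b)) := by
  have hcdf : ∀ (η : Measure ℝ) [IsFiniteMeasure η],
      MemLp (fun x => η.real (Iic x)) 2 (volume.restrict (Ioo a b)) := fun η _ =>
    MemLp.of_bound (measurable_measureReal_Iic η).aestronglyMeasurable (η.real univ)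
      (ae_of_all _ fun x => by
        rw [Real.norm_of_nonneg measureReal_nonneg]
        exact measureReal_mono (subset_univ _))
  exact (((memLp_const C).add (hcdf ηp)).sub (hcdf ηn)).ae_eq (hw.mono fun x hx => hx.symm)

/-- Calibration: if the primitive of `2λ(u - g)` takes values in `[0, 1]`, vanishes at both ends
and equals `1` on the support of `μ = u' ≥ 0`, then the energy gap controls `λ‖w - u‖²`. -/
lemma rof_gap_of_calibration {a b lam C : ℝ} (hab : a < b) {g u : ℝ → ℝ} {μ : Measure ℝ}
    [IsFiniteMeasure μ]
    (hu : ∀ᵐ x ∂(volume.restrict (Ioo a b)), u x = C + μ.real (Iic x))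
    (hg : MemLp g 2 (volume.restrict (Ioo a b)))
    (hzero : ∫ x in Ioo a b, 2 * lam * (u x - g x) = 0)
    (hbound : ∀ t, ∫ x in Ici t, 2 * lam * (u x - g x) ∂(volume.restrict (Ioo a b))
      ∈ Icc (-1 : ℝ) 0)
    (hcontact : ∀ᵐ t ∂μ,
      ∫ x in Ici t, 2 * lam * (u x - g x) ∂(volume.restrict (Ioo a b)) = -1)
    {w : ℝ → ℝ} {ηp ηn : Measure ℝ} (hw : IsDerivMeasures a b w ηp ηn) :
    IntegrableOn (fun x => (w x - u x) ^ 2) (Ioo a b) ∧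
    μ.real univ + lam * (∫ x in Ioo a b, (u x - g x) ^ 2)
        + lam * ∫ x in Ioo a b, (w x - u x) ^ 2
      ≤ ηp.real univ + ηn.real univ + lam * ∫ x in Ioo a b, (w x - g x) ^ 2 := by
  obtain ⟨D, hD⟩ := hw.exists_ae_eq hab
  obtain ⟨-, hp, hn, -⟩ := hw
  have huL : MemLp u 2 (volume.restrict (Ioo a b)) :=
    memLp_two_of_ae_eq (ηp := μ) (ηn := 0) (C := C) (by simpa using hu)
  have hwL : MemLp w 2 (volume.restrict (Ioo a b)) := memLp_two_of_ae_eq hD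
  have hsq := (hwL.sub huL).integrable_sq
  have hsq' := (huL.sub hg).integrable_sq
  have hmul : Integrable (fun x => (w x - u x) * (2 * lam * (u x - g x)))
      (volume.restrict (Ioo a b)) :=
    (hwL.sub huL).integrable_mul ((huL.sub hg).const_mul (2 * lam))
  have hζ : Integrable (fun x => 2 * lam * (u x - g x)) (volume.restrict (Ioo a b)) :=
    ((huL.sub hg).integrable one_le_two).const_mul (2 * lam)
  simp only [Pi.sub_apply] at hsq hsq'
  have hexpand : lam * ∫ x in Ioo a b, (w x - g x) ^ 2
      = lam * (∫ x in Ioo a b, (u x - g x) ^ 2) + lam * (∫ x in Ioo a b, (w x - u x) ^ 2)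
        + ∫ x in Ioo a b, (w x - u x) * (2 * lam * (u x - g x)) := by
    rw [← integral_const_mul, ← integral_const_mul, ← integral_const_mul,
      ← integral_add' (hsq'.const_mul lam) (hsq.const_mul lam),
      ← integral_add' ((hsq'.const_mul lam).add (hsq.const_mul lam)) hmul]
    congr 1; ext x; simp only [Pi.add_apply]; ring
  obtain ⟨hp1, hp2, hp3⟩ := integral_measureReal_Iic_mul (η := ηp) hζ
  obtain ⟨hn1, hn2, hn3⟩ := integral_measureReal_Iic_mul (η := ηn) hζ
  obtain ⟨hm1, hm2, hm3⟩ := integral_measureReal_Iic_mul (η := μ) hζ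
  have hcross : ∫ x in Ioo a b, (w x - u x) * (2 * lam * (u x - g x))
      = (∫ x in Ioo a b, ηp.real (Iic x) * (2 * lam * (u x - g x)))
        - (∫ x in Ioo a b, ηn.real (Iic x) * (2 * lam * (u x - g x)))
        - ∫ x in Ioo a b, μ.real (Iic x) * (2 * lam * (u x - g x)) := by
    have h0 : ∫ x in Ioo a b, (D - C) * (2 * lam * (u x - g x)) = 0 := by
      rw [integral_const_mul, hzero, mul_zero]
    have hadd := integral_add' ((hp1.sub hn1).sub hm1) (hζ.const_mul (D - C))
    rw [h0, add_zero] at hadd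
    rw [← integral_sub' hp1 hn1, ← integral_sub' (hp1.sub hn1) hm1, ← hadd]
    refine integral_congr_ae ?_
    filter_upwards [hu, hD] with x hx hx'
    simp only [Pi.add_apply, Pi.sub_apply, hx, hx']
    ring
  have hP : -ηp.real univ ≤ ∫ x in Ioo a b, ηp.real (Iic x) * (2 * lam * (u x - g x)) := by
    rw [hp3]
    have := integral_mono (integrable_const (-1 : ℝ)) hp2 fun t => (hbound t).1
    simpa using this
  have hN : ∫ x in Ioo a b, ηn.real (Iic x) * (2 * lam * (u x - g x)) ≤ ηn.real univ := by
    rw [hn3]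
    exact (integral_nonpos fun t => (hbound t).2).trans measureReal_nonneg
  have hM : ∫ x in Ioo a b, μ.real (Iic x) * (2 * lam * (u x - g x)) = -μ.real univ := by
    rw [hm3, integral_congr_ae hcontact]
    simp
  exact ⟨hsq, by rw [hexpand, hcross, hM]; linarith⟩

/-- The measure attached to a monotone function which is constant outside `[A, B]`. -/
lemma Monotone.exists_measure_of_eq_const {F : ℝ → ℝ} (hF : Monotone F) {A B c₁ c₂ : ℝ}
    (hA : ∀ x < A, F x = c₁) (hB : ∀ x, B < x → F x = c₂) :
    ∃ μ : Measure ℝ, IsFiniteMeasure μ ∧ μ (Icc A B)ᶜ = 0 ∧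
      ∀ᵐ x, F x = c₁ + μ.real (Iic x) := by
  have hleft : ∀ x < A, hF.stieltjesFunction x = c₁ := fun x hx => by
    rw [hF.stieltjesFunction_eq]
    refine rightLim_eq_of_tendsto (tendsto_const_nhds.congr' ?_)
    filter_upwards [mem_nhdsWithin_of_mem_nhds (Iio_mem_nhds hx)] with y hy using (hA y hy).symm
  have hright : ∀ x, B ≤ x → hF.stieltjesFunction x = c₂ := fun x hx => by
    rw [hF.stieltjesFunction_eq]
    refine rightLim_eq_of_tendsto (tendsto_const_nhds.congr' ?_)
    filter_upwards [self_mem_nhdsWithin] with y hy using (hB y (hx.trans_lt hy)).symm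
  have hbot : Tendsto hF.stieltjesFunction atBot (𝓝 c₁) :=
    tendsto_const_nhds.congr' ((eventually_lt_atBot A).mono fun x hx => (hleft x hx).symm)
  have htop : Tendsto hF.stieltjesFunction atTop (𝓝 c₂) :=
    tendsto_const_nhds.congr' ((eventually_ge_atTop B).mono fun x hx => (hright x hx).symm)
  refine ⟨hF.stieltjesFunction.measure, hF.stieltjesFunction.isFiniteMeasure hbot htop, ?_, ?_⟩
  · have hlim : Function.leftLim hF.stieltjesFunction A = c₁ := by
      refine leftLim_eq_of_tendsto (tendsto_const_nhds.congr' ?_)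
      filter_upwards [self_mem_nhdsWithin] with y hy using (hleft y hy).symm
    have hcompl : (Icc A B)ᶜ ⊆ Iio A ∪ Ioi B := fun x hx => by
      by_contra h
      simp only [mem_union, mem_Iio, mem_Ioi, not_or, not_lt] at h
      exact hx h
    refine measure_mono_null hcompl (measure_union_null ?_ ?_)
    · rw [hF.stieltjesFunction.measure_Iio hbot, hlim]; simp
    · rw [hF.stieltjesFunction.measure_Ioi htop, hright B le_rfl]; simp
  · filter_upwards [hF.countable_not_continuousAt.ae_notMem volume] with x hx
    have hc : ContinuousAt F x := by simpa using hx
    have hFx : hF.stieltjesFunction x = F x := by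
      rw [hF.stieltjesFunction_eq, hc.continuousWithinAt.rightLim_eq]
    rw [measureReal_def, hF.stieltjesFunction.measure_Iic hbot, ENNReal.toReal_ofReal
      (sub_nonneg.2 (hF.stieltjesFunction.mono.le_of_tendsto hbot x)), hFx]
    ring

/-- The tail integrals of a function that is a unit mass `p ≥ 0` on `]a, A[`, zero on `]A, B[` and
minus a unit mass `n ≥ 0` on `]B, b[`. -/
lemma setIntegral_Ici_of_ae_eq_sub {a A B b : ℝ} (hAB : A ≤ B) (haB : a ≤ B) (hAb : A ≤ b)
    {p n f : ℝ → ℝ} (hp : ∀ x ∈ Ioo a A, 0 ≤ p x) (hn : ∀ x ∈ Ioo B b, 0 ≤ n x)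
    (hp1 : ∫ x in Ioo a A, p x = 1) (hn1 : ∫ x in Ioo B b, n x = 1)
    (hf : ∀ᵐ x ∂(volume.restrict (Ioo a b)),
      f x = (Ioo a A).indicator p x - (Ioo B b).indicator n x) :
    ∫ x in Ioo a b, f x = 0 ∧
    (∀ t, ∫ x in Ici t, f x ∂(volume.restrict (Ioo a b)) ∈ Icc (-1 : ℝ) 0) ∧
    ∀ t ∈ Icc A B, ∫ x in Ici t, f x ∂(volume.restrict (Ioo a b)) = -1 := by
  have hpi : IntegrableOn p (Ioo a A) := Integrable.of_integral_ne_zero (by rw [hp1]; simp)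
  have hni : IntegrableOn n (Ioo B b) := Integrable.of_integral_ne_zero (by rw [hn1]; simp)
  have hsplit : ∀ s : Set ℝ, MeasurableSet s →
      ∫ x in s, f x ∂(volume.restrict (Ioo a b))
        = (∫ x in Ioo a A ∩ s, p x) - ∫ x in Ioo B b ∩ s, n x := by
    intro s hs
    have hsub1 : Ioo a A ∩ (s ∩ Ioo a b) = Ioo a A ∩ s := by
      rw [← inter_assoc]
      exact inter_eq_left.2 (inter_subset_left.trans (Ioo_subset_Ioo_right hAb))
    have hsub2 : Ioo B b ∩ (s ∩ Ioo a b) = Ioo B b ∩ s := by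
      rw [← inter_assoc]
      exact inter_eq_left.2 (inter_subset_left.trans (Ioo_subset_Ioo_left haB))
    rw [integral_congr_ae (ae_restrict_of_ae hf), Measure.restrict_restrict hs,
      integral_sub (hpi.integrable_indicator measurableSet_Ioo).integrableOn
        (hni.integrable_indicator measurableSet_Ioo).integrableOn,
      integral_indicator measurableSet_Ioo, integral_indicator measurableSet_Ioo,
      Measure.restrict_restrict measurableSet_Ioo, Measure.restrict_restrict measurableSet_Ioo,
      hsub1, hsub2]
  have hmassP : ∀ t, ∫ x in Ioo a A ∩ Ici t, p x ∈ Icc (0 : ℝ) 1 := fun t =>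
    ⟨setIntegral_nonneg (measurableSet_Ioo.inter measurableSet_Ici) fun x hx => hp x hx.1,
      hp1 ▸ setIntegral_mono_set hpi ((ae_restrict_iff' measurableSet_Ioo).2 (ae_of_all _ hp))
        inter_subset_left.eventuallyLE⟩
  have hmassN : ∀ t, ∫ x in Ioo B b ∩ Ici t, n x ∈ Icc (0 : ℝ) 1 := fun t =>
    ⟨setIntegral_nonneg (measurableSet_Ioo.inter measurableSet_Ici) fun x hx => hn x hx.1,
      hn1 ▸ setIntegral_mono_set hni ((ae_restrict_iff' measurableSet_Ioo).2 (ae_of_all _ hn))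
        inter_subset_left.eventuallyLE⟩
  have hfullN : ∀ t ≤ B, ∫ x in Ioo B b ∩ Ici t, n x = 1 := fun t ht => by
    have hsub : Ioo B b ⊆ Ici t := fun x hx => ht.trans hx.1.le
    rw [inter_eq_left.2 hsub, hn1]
  have hnoP : ∀ t, A ≤ t → ∫ x in Ioo a A ∩ Ici t, p x = 0 := fun t ht => by
    have : Ioo a A ∩ Ici t = ∅ :=
      eq_empty_of_forall_notMem fun x hx => (hx.1.2.trans_le (ht.trans hx.2)).false
    rw [this, setIntegral_empty]
  refine ⟨?_, fun t => ?_, fun t ht => ?_⟩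
  · have := hsplit univ MeasurableSet.univ
    rw [inter_univ, inter_univ, hp1, hn1, Measure.restrict_univ] at this
    rw [this, sub_self]
  · rw [hsplit _ measurableSet_Ici]
    have hP := hmassP t
    have hN := hmassN t
    rcases le_total t B with h | h
    · rw [hfullN t h]
      exact ⟨by linarith [hP.1], by linarith [hP.2]⟩
    · rw [hnoP t (hAB.trans h)]
      exact ⟨by linarith [hN.2], by linarith [hN.1]⟩
  · rw [hsplit _ measurableSet_Ici, hfullN t ht.2, hnoP t ht.1, zero_sub]

lemma lt_of_lt_gInv {a b c x : ℝ} {g : ℝ → ℝ} (hx : x ∈ Icc a b) (h : x < gInv a b g c) :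
    g x < c := by
  by_contra hcon
  exact h.not_ge (csInf_le ⟨a, fun y hy => hy.1.1⟩ ⟨hx, not_lt.1 hcon⟩)

lemma le_of_gInv_lt {a b c x : ℝ} {g : ℝ → ℝ} (hg : MonotoneOn g (Icc a b)) (hb : c ≤ g b)
    (hab : a ≤ b) (hx : x ≤ b) (h : gInv a b g c < x) : c ≤ g x := by
  obtain ⟨y, hy, hyx⟩ := exists_lt_of_csInf_lt
    (s := {x | x ∈ Icc a b ∧ c ≤ g x}) ⟨b, right_mem_Icc.2 hab, hb⟩ h
  exact hy.2.trans (hg hy.1 ⟨hy.1.1.trans hyx.le, hx⟩ hyx.le)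

lemma gInv_mem_Icc {a b c : ℝ} {g : ℝ → ℝ} (hab : a ≤ b) (hb : c ≤ g b) :
    gInv a b g c ∈ Icc a b :=
  ⟨le_csInf ⟨b, right_mem_Icc.2 hab, hb⟩ fun _ hy => hy.1.1,
    csInf_le ⟨a, fun _ hy => hy.1.1⟩ ⟨right_mem_Icc.2 hab, hb⟩⟩

lemma gInv_mono {a b c₁ c₂ : ℝ} {g : ℝ → ℝ} (hab : a ≤ b) (hb : c₂ ≤ g b) (h : c₁ ≤ c₂) :
    gInv a b g c₁ ≤ gInv a b g c₂ :=
  csInf_le_csInf ⟨a, fun _ hy => hy.1.1⟩ ⟨b, right_mem_Icc.2 hab, hb⟩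
    fun _ hy => ⟨hy.1, h.trans hy.2⟩

/-- A monotone function that agrees with `rofU` except possibly at `gInv a b g c₂`, where `rofU`
may fail to be monotone. -/
lemma monotone_rofU_modification {a b c₁ c₂ : ℝ} {g : ℝ → ℝ} (hab : a ≤ b)
    (hg : MonotoneOn g (Icc a b)) (hb : c₂ ≤ g b) (hcc : c₁ ≤ c₂) :
    Monotone fun x =>
      if x ≤ gInv a b g c₁ then c₁ else if x < gInv a b g c₂ then g x else c₂ := by
  have hA := gInv_mem_Icc hab (hcc.trans hb)
  have hB := gInv_mem_Icc hab hb
  intro x y hxy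
  simp only
  split_ifs with h1 h2 h3 h4 h5 h6 h7 h8
  · exact le_rfl
  · exact le_of_gInv_lt hg (hcc.trans hb) hab (h3.le.trans hB.2) (not_le.1 h2)
  · exact hcc
  · exact absurd (hxy.trans h5) h1
  · exact hg ⟨hA.1.trans (not_le.1 h1).le, h4.le.trans hB.2⟩
      ⟨hA.1.trans (not_le.1 h5).le, h6.le.trans hB.2⟩ hxy
  · exact (lt_of_lt_gInv ⟨hA.1.trans (not_le.1 h1).le, h4.le.trans hB.2⟩ h4).le
  · exact absurd (hxy.trans h7) h1
  · exact absurd (hxy.trans_lt h8) h4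
  · exact le_rfl

lemma ROFenergy_eq_ofReal {a b lam : ℝ} (hlam : 0 ≤ lam) {g w : ℝ → ℝ} {ηp ηn : Measure ℝ}
    (hw : IsDerivMeasures a b w ηp ηn) :
    ROFenergy a b lam g w ηp ηn = ENNReal.ofReal
      (ηp.real univ + ηn.real univ + lam * ∫ x in Ioo a b, (w x - g x) ^ 2) := by
  obtain ⟨-, hp, hn, -, hp0, hn0, -⟩ := hw
  have hfull : ∀ η : Measure ℝ, η (Ioo a b)ᶜ = 0 → η (Ioo a b) = η univ := fun η h =>
    measure_congr (eventuallyEq_univ.2 (mem_ae_iff.2 h))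
  rw [ROFenergy, Measure.add_apply, hfull _ hp0, hfull _ hn0,
    ENNReal.ofReal_add (add_nonneg measureReal_nonneg measureReal_nonneg)
      (mul_nonneg hlam (integral_nonneg fun _ => sq_nonneg _)),
    ENNReal.ofReal_add measureReal_nonneg measureReal_nonneg, ofReal_measureReal,
    ofReal_measureReal]

/-- for a nondecreasing datum `g : [a,b] → [0,1]` with `g₊(a) = 0`,
`g₋(b) = 1`, and `c₁ < c₂` satisfying the two normalization identities, the truncated
function `rofU` is the unique minimizer of `ROF_{λ,g}` over `BV(]a,b[)`. -/
theorem statement_11 (a b lam : ℝ) (hab : a < b) (hlam : 0 < lam)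
    (g : ℝ → ℝ)
    (hmono : MonotoneOn g (Set.Icc a b))
    (hrange : ∀ x ∈ Set.Icc a b, g x ∈ Set.Icc (0 : ℝ) 1)
    (hga : Tendsto g (𝓝[>] a) (𝓝 0))
    (hgb : Tendsto g (𝓝[<] b) (𝓝 1))
    (c₁ c₂ : ℝ) (hc₁ : 0 < c₁) (hcc : c₁ < c₂) (hc₂ : c₂ < 1)
    (h1 : 2 * lam * ∫ x in Set.Ioo a (gInv a b g c₁), (c₁ - g x) = 1)
    (h2 : 2 * lam * ∫ x in Set.Ioo (gInv a b g c₂) b, (g x - c₂) = 1) :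
    ∃ μp μn : Measure ℝ,
      IsDerivMeasures a b (rofU a b g c₁ c₂) μp μn ∧
      ∀ (w : ℝ → ℝ) (ηp ηn : Measure ℝ), IsDerivMeasures a b w ηp ηn →
        ROFenergy a b lam g (rofU a b g c₁ c₂) μp μn ≤ ROFenergy a b lam g w ηp ηn ∧
        (ROFenergy a b lam g (rofU a b g c₁ c₂) μp μn = ROFenergy a b lam g w ηp ηn →
          ∀ᵐ x ∂(MeasureTheory.volume.restrict (Set.Ioo a b)),
            w x = rofU a b g c₁ c₂ x) := by
  have hgb1 : g b = 1 := le_antisymm (hrange b (right_mem_Icc.2 hab.le)).2 <| by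
    refine le_of_tendsto hgb ?_
    filter_upwards [Ioo_mem_nhdsLT hab] with x hx
    exact hmono (Ioo_subset_Icc_self hx) (right_mem_Icc.2 hab.le) hx.2.le
  have hb2 : c₂ ≤ g b := hgb1 ▸ hc₂.le
  have hb1 : c₁ ≤ g b := hcc.le.trans hb2
  set A := gInv a b g c₁ with hAdef
  set B := gInv a b g c₂ with hBdef
  have hA : A ∈ Icc a b := gInv_mem_Icc hab.le hb1
  have hB : B ∈ Icc a b := gInv_mem_Icc hab.le hb2
  have hAB : A ≤ B := gInv_mono hab.le hb2 hcc.le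
  have haA : a < A := by
    by_contra h
    rw [Ioo_eq_empty h] at h1
    simp at h1
  have hBb : B < b := by
    by_contra h
    rw [Ioo_eq_empty h] at h2
    simp at h2
  have hF := monotone_rofU_modification hab.le hmono hb2 hcc.le
  obtain ⟨μ, hμfin, hμ0, hμ⟩ := hF.exists_measure_of_eq_const (A := A) (B := B) (c₁ := c₁)
    (c₂ := c₂) (fun x hx => if_pos hx.le)
    (fun x hx => by rw [if_neg (hAB.trans_lt hx).not_ge, if_neg hx.not_gt])
  have hne : ∀ y : ℝ, ∀ᵐ x : ℝ, x ≠ y := fun y => by simp [ae_iff]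
  have hu : ∀ᵐ x ∂(volume.restrict (Ioo a b)), rofU a b g c₁ c₂ x = c₁ + μ.real (Iic x) := by
    refine ae_restrict_of_ae ?_
    filter_upwards [hμ, hne B] with x hx hxB
    rw [← hx, rofU]
    simp only [← hAdef, ← hBdef, lt_iff_le_and_ne, hxB, ne_eq, not_false_eq_true, and_true]
  have hμIoo : μ (Ioo a b)ᶜ = 0 :=
    measure_mono_null (compl_subset_compl.2 (Icc_subset_Ioo haA hBb)) hμ0
  have hU := isDerivMeasures_of_ae_eq hab hμIoo hu
  have hgL : MemLp g 2 (volume.restrict (Ioo a b)) := by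
    refine MemLp.of_bound (aemeasurable_restrict_of_monotoneOn measurableSet_Ioo
      (hmono.mono Ioo_subset_Icc_self)).aestronglyMeasurable 1
      ((ae_restrict_iff' measurableSet_Ioo).2 (ae_of_all _ fun x hx => ?_))
    have := hrange x (Ioo_subset_Icc_self hx)
    rw [Real.norm_of_nonneg this.1]
    exact this.2
  obtain ⟨hzero, hbound, hcontact⟩ := setIntegral_Ici_of_ae_eq_sub (a := a) (b := b) hAB hB.1 hA.2
    (p := fun x => 2 * lam * (c₁ - g x)) (n := fun x => 2 * lam * (g x - c₂))
    (f := fun x => 2 * lam * (rofU a b g c₁ c₂ x - g x))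
    (fun x hx => mul_nonneg (by positivity)
      (sub_nonneg.2 (lt_of_lt_gInv ⟨hx.1.le, hx.2.le.trans hA.2⟩ hx.2).le))
    (fun x hx => mul_nonneg (by positivity)
      (sub_nonneg.2 (le_of_gInv_lt hmono hb2 hab.le hx.2.le hx.1)))
    (by rw [integral_const_mul, h1]) (by rw [integral_const_mul, h2]) (by
      rw [ae_restrict_iff' measurableSet_Ioo]
      filter_upwards [hne A, hne B] with x hxA hxB hx
      rw [rofU, ← hAdef, ← hBdef]
      rcases lt_or_gt_of_ne hxA with h | h
      · have hnot : x ∉ Ioo B b := fun h' => (h.trans_le hAB).not_gt h'.1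
        rw [if_pos h.le, indicator_of_mem (show x ∈ Ioo a A from ⟨hx.1, h⟩),
          indicator_of_notMem hnot, sub_zero]
      · have hnot : x ∉ Ioo a A := fun h' => h.not_gt h'.2
        rw [if_neg h.not_ge, indicator_of_notMem hnot]
        rcases lt_or_gt_of_ne hxB with h' | h'
        · rw [if_pos h'.le, indicator_of_notMem fun h'' : x ∈ Ioo B b => h'.not_gt h''.1]
          ring
        · rw [if_neg h'.not_ge, indicator_of_mem (show x ∈ Ioo B b from ⟨h', hx.2⟩)]
          ring)
  refine ⟨μ, 0, hU, fun w ηp ηn hw => ?_⟩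
  obtain ⟨hInt, hgap⟩ := rof_gap_of_calibration (lam := lam) hab hu hgL hzero hbound
    (by filter_upwards [mem_ae_iff.2 hμ0] with t ht using hcontact t ht) hw
  have hnonneg : 0 ≤ ∫ x in Ioo a b, (w x - rofU a b g c₁ c₂ x) ^ 2 :=
    integral_nonneg fun _ => sq_nonneg _
  have hpos : ∀ v : ℝ → ℝ, 0 ≤ lam * ∫ x in Ioo a b, (v x - g x) ^ 2 := fun v =>
    mul_nonneg hlam.le (integral_nonneg fun _ => sq_nonneg _)
  rw [ROFenergy_eq_ofReal hlam.le hU, ROFenergy_eq_ofReal hlam.le hw]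
  simp only [measureReal_zero_apply, add_zero]
  refine ⟨ENNReal.ofReal_le_ofReal (by linarith [mul_nonneg hlam.le hnonneg]), fun heq => ?_⟩
  rw [ENNReal.ofReal_eq_ofReal_iff (add_nonneg measureReal_nonneg (hpos _))
    (add_nonneg (add_nonneg measureReal_nonneg measureReal_nonneg) (hpos _))] at heq
  have hle : ∫ x in Ioo a b, (w x - rofU a b g c₁ c₂ x) ^ 2 ≤ 0 :=
    nonpos_of_mul_nonpos_right (by linarith) hlam
  have hae := (integral_eq_zero_iff_of_nonneg (fun _ => sq_nonneg _) hInt).1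
    (le_antisymm hle hnonneg)
  filter_upwards [hae] with x hx
  exact sub_eq_zero.1 (pow_eq_zero_iff two_ne_zero |>.1 hx)
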